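/- In the game Corner the Two Rooks (two rooks on an unbounded chessboard with upper-left corner (0,0); a move replaces one rook's position (a,b) by (a',b) with a' < a or by (a,b') with b' < b, where a rook may jump over the other rook but the two rooks may never occupy the same square; the player unable to move loses), the set of P-positions is exactly 𝒫 = ({(x,y,z,w) : x ⊕ y ⊕ z ⊕ w = 0} ∪ 𝒫₁) − 𝒩₀, where 𝒫₁ = {(2n,m,2n+1,m) : n,m ∈ ℤ≥0} ∪ {(2n+1,m,2n,m) : n,m ∈ ℤ≥0} ∪ {(n,2m+1,n,2m) : n,m ∈ ℤ≥0} ∪ {(n,2m,n,2m+1) : n,m ∈ ℤ≥0} and 𝒩₀ = {(2n,2m,2n+1,2m+1) : n,m ∈ ℤ≥0} ∪ {(2n+1,2m+1,2n,2m) : n,m ∈ ℤ≥0} ∪ {(2n+1,2m,2n,2m+1) : n,m ∈ ℤ≥0} ∪ {(2n,2m+1,2n+1,2m) : n,m ∈ ℤ≥0}. -/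

import Mathlib

mutual
  /-- P-position: the previous player (who just moved) can force a win. -/
  inductive PPosition {α : Type} (Move : α → α → Prop) : α → Prop
    | intro (p : α) (h : ∀ q, Move p q → NPosition Move q) : PPosition Move p
  /-- N-position: the player to move can force a win. -/
  inductive NPosition {α : Type} (Move : α → α → Prop) : α → Prop
    | intro (p q : α) (h : Move p q) (hq : PPosition Move q) : NPosition Move p
end

/-- Moves of "Corner the Two Rooks": a position `(x, y, z, w)` records the squares
`(x, y)` and `(z, w)` of the two rooks; a move strictly decreases exactly one
coordinate of exactly one rook (the rook moves leftward or upward as far as desired,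
possibly jumping over the other rook), and the two rooks may never occupy the same
square. -/
def RookMove : ℕ × ℕ × ℕ × ℕ → ℕ × ℕ × ℕ × ℕ → Prop :=
  fun (x, y, z, w) (x', y', z', w') =>
    (x', y') ≠ (z', w') ∧
      (((z', w') = (z, w) ∧ ((y' = y ∧ x' < x) ∨ (x' = x ∧ y' < y))) ∨
        ((x', y') = (x, y) ∧ ((w' = w ∧ z' < z) ∨ (z' = z ∧ w' < w))))

/-- `𝒫₁ = {(2n,m,2n+1,m)} ∪ {(2n+1,m,2n,m)} ∪ {(n,2m+1,n,2m)} ∪ {(n,2m,n,2m+1)}`,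
with `n, m` ranging over the nonnegative integers. -/
def calP1 : Set (ℕ × ℕ × ℕ × ℕ) :=
  {p | ∃ n m : ℕ, p = (2 * n, m, 2 * n + 1, m)} ∪
  {p | ∃ n m : ℕ, p = (2 * n + 1, m, 2 * n, m)} ∪
  {p | ∃ n m : ℕ, p = (n, 2 * m + 1, n, 2 * m)} ∪
  {p | ∃ n m : ℕ, p = (n, 2 * m, n, 2 * m + 1)}

/-- `𝒩₀ = {(2n,2m,2n+1,2m+1)} ∪ {(2n+1,2m+1,2n,2m)} ∪ {(2n+1,2m,2n,2m+1)} ∪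
{(2n,2m+1,2n+1,2m)}`, with `n, m` ranging over the nonnegative integers. -/
def calN0 : Set (ℕ × ℕ × ℕ × ℕ) :=
  {p | ∃ n m : ℕ, p = (2 * n, 2 * m, 2 * n + 1, 2 * m + 1)} ∪
  {p | ∃ n m : ℕ, p = (2 * n + 1, 2 * m + 1, 2 * n, 2 * m)} ∪
  {p | ∃ n m : ℕ, p = (2 * n + 1, 2 * m, 2 * n, 2 * m + 1)} ∪
  {p | ∃ n m : ℕ, p = (2 * n, 2 * m + 1, 2 * n + 1, 2 * m)}

/-- `𝒫 = ({(x,y,z,w) : x ⊕ y ⊕ z ⊕ w = 0} ∪ 𝒫₁) − 𝒩₀`. -/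
def calP : Set (ℕ × ℕ × ℕ × ℕ) :=
  ({p | p.1 ^^^ p.2.1 ^^^ p.2.2.1 ^^^ p.2.2.2 = 0} ∪ calP1) \ calN0

theorem pPosition_iff_and_nPosition_iff {α : Type} {Move : α → α → Prop} (μ : α → ℕ)
    (hμ : ∀ p q, Move p q → μ q < μ p) {L Q : α → Prop} (hL : ∀ p q, Move p q → L q)
    (hQ : ∀ p q, L p → Q p → Move p q → ¬ Q q)
    (hN : ∀ p, L p → ¬ Q p → ∃ q, Move p q ∧ Q q) (p : α) (hp : L p) :
    (PPosition Move p ↔ Q p) ∧ (NPosition Move p ↔ ¬ Q p) := by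
  induction h : μ p using Nat.strong_induction_on generalizing p with
  | _ k ih =>
    have ih' : ∀ q, Move p q →
        (PPosition Move q ↔ Q q) ∧ (NPosition Move q ↔ ¬ Q q) := fun q hq =>
      ih (μ q) (h ▸ hμ p q hq) q (hL p q hq) rfl
    refine ⟨⟨fun hP => ?_, fun hq => ?_⟩, ⟨fun hP => ?_, fun hq => ?_⟩⟩
    · by_contra hq
      obtain ⟨q, hm, hqq⟩ := hN p hp hq
      cases hP with
      | intro _ hall => exact (ih' q hm).2.1 (hall q hm) hqq
    · exact .intro p fun q hm => (ih' q hm).2.2 (hQ p q hp hq hm)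
    · cases hP with
      | intro _ q hm hPq => exact fun hq => hQ p q hp hq hm ((ih' q hm).1.1 hPq)
    · obtain ⟨q, hm, hqq⟩ := hN p hp hq
      exact .intro p q hm ((ih' q hm).1.2 hqq)

/-- The set `calP`, expressed through `a = x ⊕ z` and `b = y ⊕ w`. -/
def XorCriterion (a b : ℕ) : Prop :=
  (a = b ∧ 2 ≤ a) ∨ (a = 0 ∧ b = 1) ∨ (a = 1 ∧ b = 0)

theorem xor_eq_one_iff {x z : ℕ} :
    x ^^^ z = 1 ↔ ∃ n, (x = 2 * n ∧ z = 2 * n + 1) ∨ (x = 2 * n + 1 ∧ z = 2 * n) := by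
  constructor
  · intro h
    have h₁ : x / 2 ^^^ z / 2 = 0 := by rw [← Nat.xor_div_two, h]
    have h₂ : (x + z) % 2 = 1 := by rw [← Nat.xor_mod_two_eq, h]
    rw [Nat.xor_eq_zero_iff] at h₁
    exact ⟨x / 2, by omega⟩
  · rintro ⟨n, ⟨rfl, rfl⟩ | ⟨rfl, rfl⟩⟩
    · rw [← Nat.xor_one_of_even (even_two_mul n), ← Nat.xor_assoc, Nat.xor_self, Nat.zero_xor]
    · rw [← Nat.xor_one_of_even (even_two_mul n), Nat.xor_comm, ← Nat.xor_assoc, Nat.xor_self,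
        Nat.zero_xor]

theorem mem_calP1_iff (x y z w : ℕ) : (x, y, z, w) ∈ calP1 ↔
    (x ^^^ z = 1 ∧ y ^^^ w = 0) ∨ (x ^^^ z = 0 ∧ y ^^^ w = 1) := by
  simp only [xor_eq_one_iff, Nat.xor_eq_zero_iff, calP1, Set.mem_union, Set.mem_ofPred_eq,
    Prod.mk.injEq]
  grind

theorem mem_calN0_iff (x y z w : ℕ) : (x, y, z, w) ∈ calN0 ↔ x ^^^ z = 1 ∧ y ^^^ w = 1 := by
  simp only [xor_eq_one_iff, calN0, Set.mem_union, Set.mem_ofPred_eq, Prod.mk.injEq]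
  grind

theorem mem_calP_iff (x y z w : ℕ) (hne : (x, y) ≠ (z, w)) :
    (x, y, z, w) ∈ calP ↔ XorCriterion (x ^^^ z) (y ^^^ w) := by
  have hx : x ^^^ y ^^^ z ^^^ w = 0 ↔ x ^^^ z = y ^^^ w := by
    rw [← Nat.xor_eq_zero_iff (x := x ^^^ z)]
    have : x ^^^ y ^^^ z ^^^ w = x ^^^ z ^^^ (y ^^^ w) := by ac_rfl
    rw [this]
  have h0 : ¬ (x ^^^ z = 0 ∧ y ^^^ w = 0) := by
    simpa [Nat.xor_eq_zero_iff] using hne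
  rw [calP, Set.mem_sdiff, Set.mem_union, mem_calP1_iff, mem_calN0_iff, Set.mem_ofPred_eq, hx,
    XorCriterion]
  omega

theorem exists_lt_xor_eq {x z c : ℕ} (h : c < x ^^^ z) :
    (∃ x' < x, x' ^^^ z = c) ∨ ∃ z' < z, x ^^^ z' = c := by
  rcases Nat.lt_xor_cases h with h | h
  · exact .inl ⟨_, h, by rw [Nat.xor_assoc, Nat.xor_self, Nat.xor_zero]⟩
  · exact .inr ⟨_, h, by rw [Nat.xor_comm c, ← Nat.xor_assoc, Nat.xor_self, Nat.zero_xor]⟩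

theorem XorCriterion.ne {x y z w : ℕ} (h : XorCriterion (x ^^^ z) (y ^^^ w)) :
    (x, y) ≠ (z, w) := by
  rintro ⟨⟩
  simp [XorCriterion] at h

/-- A position outside the criterion can be moved into it by decreasing one of the nim-sums. -/
theorem XorCriterion.exists_lt {a b : ℕ} (h : ¬ XorCriterion a b) (h0 : ¬ (a = 0 ∧ b = 0)) :
    (∃ c < a, XorCriterion c b) ∨ ∃ c < b, XorCriterion a c := by
  unfold XorCriterion at *
  by_cases hb : b ≤ 1
  · by_cases ha : a ≤ 1
    · exact .inl ⟨0, by omega, by omega⟩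
    · exact .inl ⟨1 - b, by omega, by omega⟩
  · by_cases ha : a ≤ 1
    · exact .inr ⟨1 - a, by omega, by omega⟩
    · rcases lt_or_ge b a with hab | hab
      · exact .inl ⟨b, hab, by omega⟩
      · exact .inr ⟨a, by omega, by omega⟩

theorem XorCriterion.left_unique {a a' b : ℕ} (h : XorCriterion a b) (h' : XorCriterion a' b) :
    a = a' := by
  unfold XorCriterion at *
  omega

theorem XorCriterion.right_unique {a b b' : ℕ} (h : XorCriterion a b) (h' : XorCriterion a b') :
    b = b' := by
  unfold XorCriterion at *
  omega

theorem not_xorCriterion_of_rookMove {x y z w x' y' z' w' : ℕ}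
    (h : XorCriterion (x ^^^ z) (y ^^^ w)) (hm : RookMove (x, y, z, w) (x', y', z', w')) :
    ¬ XorCriterion (x' ^^^ z') (y' ^^^ w') := by
  intro h'
  simp only [RookMove, Prod.mk.injEq] at hm
  obtain ⟨-, ⟨⟨rfl, rfl⟩, ⟨rfl, hlt⟩ | ⟨rfl, hlt⟩⟩ | ⟨⟨rfl, rfl⟩, ⟨rfl, hlt⟩ | ⟨rfl, hlt⟩⟩⟩ := hm
  · exact hlt.ne' (Nat.xor_left_injective (h.left_unique h'))
  · exact hlt.ne' (Nat.xor_left_injective (h.right_unique h'))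
  · exact hlt.ne' (Nat.xor_right_injective (h.left_unique h'))
  · exact hlt.ne' (Nat.xor_right_injective (h.right_unique h'))

theorem exists_rookMove_xorCriterion {x y z w : ℕ} (hne : (x, y) ≠ (z, w))
    (h : ¬ XorCriterion (x ^^^ z) (y ^^^ w)) :
    ∃ x' y' z' w', RookMove (x, y, z, w) (x', y', z', w') ∧
      XorCriterion (x' ^^^ z') (y' ^^^ w') := by
  have h0 : ¬ (x ^^^ z = 0 ∧ y ^^^ w = 0) := by
    simpa [Nat.xor_eq_zero_iff] using hne
  rcases XorCriterion.exists_lt h h0 with ⟨c, hc, hq⟩ | ⟨c, hc, hq⟩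
  · rcases exists_lt_xor_eq hc with ⟨t, ht, rfl⟩ | ⟨t, ht, rfl⟩
    · exact ⟨t, y, z, w, ⟨hq.ne, .inl ⟨rfl, .inl ⟨rfl, ht⟩⟩⟩, hq⟩
    · exact ⟨x, y, t, w, ⟨hq.ne, .inr ⟨rfl, .inl ⟨rfl, ht⟩⟩⟩, hq⟩
  · rcases exists_lt_xor_eq hc with ⟨t, ht, rfl⟩ | ⟨t, ht, rfl⟩
    · exact ⟨x, t, z, w, ⟨hq.ne, .inl ⟨rfl, .inr ⟨rfl, ht⟩⟩⟩, hq⟩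
    · exact ⟨x, y, z, t, ⟨hq.ne, .inr ⟨rfl, .inr ⟨rfl, ht⟩⟩⟩, hq⟩

/-- In Corner the Two Rooks, a position `(x, y, z, w)` with the two rooks on distinct
squares is a P-position if and only if it belongs to
`𝒫 = ({(x,y,z,w) : x ⊕ y ⊕ z ⊕ w = 0} ∪ 𝒫₁) − 𝒩₀`. -/
theorem cornerTheTwoRooks_PPositions (x y z w : ℕ) (hne : (x, y) ≠ (z, w)) :
    PPosition RookMove (x, y, z, w) ↔ (x, y, z, w) ∈ calP := by
  rw [mem_calP_iff x y z w hne]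
  refine (pPosition_iff_and_nPosition_iff (Move := RookMove)
    (fun p => p.1 + p.2.1 + p.2.2.1 + p.2.2.2)
    (L := fun p => (p.1, p.2.1) ≠ (p.2.2.1, p.2.2.2))
    (Q := fun p => XorCriterion (p.1 ^^^ p.2.2.1) (p.2.1 ^^^ p.2.2.2))
    ?_ ?_ ?_ ?_ (x, y, z, w) hne).1
  · rintro ⟨x, y, z, w⟩ ⟨x', y', z', w'⟩ hm
    simp only [RookMove, Prod.mk.injEq] at hm
    dsimp only
    omega
  · rintro ⟨x, y, z, w⟩ ⟨x', y', z', w'⟩ hm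
    exact hm.1
  · rintro ⟨x, y, z, w⟩ ⟨x', y', z', w'⟩ - hq hm
    exact not_xorCriterion_of_rookMove hq hm
  · rintro ⟨x, y, z, w⟩ hp hq
    obtain ⟨x', y', z', w', h⟩ := exists_rookMove_xorCriterion hp hq
    exact ⟨(x', y', z', w'), h⟩
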